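/- Let G be an IMM execution graph satisfying rf-completeness (codom(rf) = R) and co-totality (for every location x, co totally orders the writes to x). Then hb;eco^? is irreflexive if and only if hb|loc ∪ rf ∪ co ∪ fr is acyclic. -/

import Mathlib

/-! ## Basic definitions: events, labels, relations -/

abbrev Loc := ℕ
abbrev Val := ℕ

inductive Mode
  | rlx | acq | rel | acqrel | sc
deriving DecidableEq

inductive ExFlag
  | notex | ex
deriving DecidableEq

inductive Strength
  | normal | strong
deriving DecidableEq

inductive Label
  | read (o : Mode) (x : Loc) (v : Val) (s : ExFlag)
  | write (o : Mode) (x : Loc) (v : Val) (st : Strength)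
  | fence (o : Mode)
deriving DecidableEq

inductive Event
  | init (x : Loc)
  | ev (tid : ℕ) (sn : ℚ)
deriving DecidableEq

def Event.isInit : Event → Prop
  | .init _ => True
  | .ev _ _ => False

/-- the set of initialization events -/
def InitE : Set Event := {e | e.isInit}

/-- the `sequenced-before` partial order on events: initialization events precede all
non-initialization events, and events of the same thread are ordered by serial number -/
def evLt : Event → Event → Prop
  | .init _, .ev _ _ => True
  | .ev i n, .ev j m => i = j ∧ n < m
  | _, _ => False

abbrev REv := Event → Event → Prop

/-- relational composition `r ; s` -/
def seqR (r s : REv) : REv := fun a c => ∃ b, r a b ∧ s b c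

infixr:70 " ⬝ " => seqR

/-- identity relation on a set: `[A]` -/
def eqv (A : Set Event) : REv := fun a b => a = b ∧ a ∈ A

notation:max "⦗" A "⦘" => eqv A

/-- union of relations -/
def runion (r s : REv) : REv := fun a b => r a b ∨ s a b

infixl:65 " ∪ᵣ " => runion

/-- reflexive closure `r^?` -/
def rcl (r : REv) : REv := fun a b => a = b ∨ r a b

/-- transitive closure `r⁺` -/
def tcl (r : REv) : REv := Relation.TransGen r

/-- reflexive-transitive closure `r*` -/
def rtcl (r : REv) : REv := Relation.ReflTransGen r

/-- inverse relation `r⁻¹` -/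
def transp (r : REv) : REv := fun a b => r b a

def rdom (r : REv) : Set Event := {a | ∃ b, r a b}

def rcodom (r : REv) : Set Event := {b | ∃ a, r a b}

/-- immediate edges: `imm(r) = r ∖ r;r` -/
def immediate (r : REv) : REv := fun a b => r a b ∧ ¬ (r ⬝ r) a b

def acyclic (r : REv) : Prop := Irreflexive (tcl r)

/-- `r` totally orders `A` -/
def totalOn (A : Set Event) (r : REv) : Prop :=
  ∀ a ∈ A, ∀ b ∈ A, a ≠ b → r a b ∨ r b a

def Label.locOf : Label → Option Loc
  | .read _ x _ _ => some x
  | .write _ x _ _ => some x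
  | .fence _ => none

def Label.valOf : Label → Option Val
  | .read _ _ v _ => some v
  | .write _ _ v _ => some v
  | .fence _ => none

/-! ## IMM execution graphs -/

structure Execution where
  E : Set Event
  lab : Event → Label
  rmw : REv
  data : REv
  addr : REv
  ctrl : REv
  casdep : REv
  rf : REv
  co : REv

namespace Execution

variable (G : Execution)

def loc (e : Event) : Option Loc := (G.lab e).locOf
def valu (e : Event) : Option Val := (G.lab e).valOf

/-- read events -/
def R : Set Event := {e | e ∈ G.E ∧ ∃ o x v s, G.lab e = .read o x v s}
/-- write events -/
def W : Set Event := {e | e ∈ G.E ∧ ∃ o x v st, G.lab e = .write o x v st}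
/-- fence events -/
def F : Set Event := {e | e ∈ G.E ∧ ∃ o, G.lab e = .fence o}
/-- acquire reads -/
def Racq : Set Event := {e | e ∈ G.E ∧ ∃ x v s, G.lab e = .read .acq x v s}
/-- exclusive reads -/
def Rex : Set Event := {e | e ∈ G.E ∧ ∃ o x v, G.lab e = .read o x v .ex}
/-- release writes -/
def Wrel : Set Event := {e | e ∈ G.E ∧ ∃ x v st, G.lab e = .write .rel x v st}
/-- strong writes -/
def Wstrong : Set Event := {e | e ∈ G.E ∧ ∃ o x v, G.lab e = .write o x v .strong}
/-- writes to location `x` -/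
def Wloc (x : Loc) : Set Event := {e | e ∈ G.W ∧ G.loc e = some x}
/-- reads from location `x` -/
def Rloc (x : Loc) : Set Event := {e | e ∈ G.R ∧ G.loc e = some x}
/-- SC fences -/
def Fsc : Set Event := {e | e ∈ G.E ∧ G.lab e = .fence .sc}
/-- fences of mode exactly `rel` -/
def Frel : Set Event := {e | e ∈ G.E ∧ G.lab e = .fence .rel}
/-- fences whose mode is at least `rel` (i.e. `rel`, `acqrel` or `sc`) -/
def FgeRel : Set Event :=
  {e | e ∈ G.E ∧ (G.lab e = .fence .rel ∨ G.lab e = .fence .acqrel ∨ G.lab e = .fence .sc)}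
/-- fences whose mode is at least `acq` (i.e. `acq`, `acqrel` or `sc`) -/
def FgeAcq : Set Event :=
  {e | e ∈ G.E ∧ (G.lab e = .fence .acq ∨ G.lab e = .fence .acqrel ∨ G.lab e = .fence .sc)}

/-- program order -/
def po : REv := fun a b => a ∈ G.E ∧ b ∈ G.E ∧ evLt a b

/-- both events access the same location -/
def sameLoc : REv := fun a b => ∃ x, G.loc a = some x ∧ G.loc b = some x

/-- `po|loc` -/
def poloc : REv := fun a b => G.po a b ∧ G.sameLoc a b

def rfi : REv := fun a b => G.rf a b ∧ G.po a b
def rfe : REv := fun a b => G.rf a b ∧ ¬ G.po a b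
def coi : REv := fun a b => G.co a b ∧ G.po a b
def coe : REv := fun a b => G.co a b ∧ ¬ G.po a b

/-- from-read -/
def fr : REv := transp G.rf ⬝ G.co
def fri : REv := fun a b => G.fr a b ∧ G.po a b
def fre : REv := fun a b => G.fr a b ∧ ¬ G.po a b

/-- release sequence -/
def rs : REv :=
  ⦗G.W⦘ ⬝ G.poloc ⬝ ⦗G.W⦘ ∪ᵣ ⦗G.W⦘ ⬝ rtcl (rcl G.poloc ⬝ G.rf ⬝ G.rmw)

/-- release prefix -/
def release : REv := (⦗G.Wrel⦘ ∪ᵣ ⦗G.FgeRel⦘ ⬝ G.po) ⬝ G.rs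

/-- synchronizes with -/
def sw : REv :=
  G.release ⬝ (G.rfi ∪ᵣ rcl G.poloc ⬝ G.rfe) ⬝ (⦗G.Racq⦘ ∪ᵣ G.po ⬝ ⦗G.FgeAcq⦘)

/-- happens-before -/
def hb : REv := tcl (G.po ∪ᵣ G.sw)

/-- extended coherence order -/
def eco : REv := G.rf ∪ᵣ G.co ⬝ rcl G.rf ∪ᵣ G.fr ⬝ rcl G.rf

/-- barrier order -/
def bob : REv :=
  G.po ⬝ ⦗G.Wrel⦘ ∪ᵣ ⦗G.Racq⦘ ⬝ G.po ∪ᵣ G.po ⬝ ⦗G.F⦘ ∪ᵣ ⦗G.F⦘ ⬝ G.po ∪ᵣ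
    ⦗G.Wrel⦘ ⬝ G.poloc ⬝ ⦗G.W⦘

/-- syntactic dependencies -/
def deps : REv :=
  G.data ∪ᵣ G.ctrl ∪ᵣ G.addr ⬝ rcl G.po ∪ᵣ G.casdep ∪ᵣ ⦗G.Rex⦘ ⬝ G.po

/-- preserved program order -/
def ppo : REv := ⦗G.R⦘ ⬝ tcl (G.deps ∪ᵣ G.rfi) ⬝ ⦗G.W⦘

def detour : REv := fun a b => (G.coe ⬝ G.rfe) a b ∧ G.po a b

/-- partial SC fence order -/
def psc : REv := ⦗G.Fsc⦘ ⬝ G.hb ⬝ G.eco ⬝ G.hb ⬝ ⦗G.Fsc⦘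

/-- the acyclicity relation of IMM -/
def ar : REv :=
  G.rfe ∪ᵣ G.bob ∪ᵣ G.ppo ∪ᵣ G.detour ∪ᵣ G.psc ∪ᵣ ⦗G.Wstrong⦘ ⬝ G.po ⬝ ⦗G.W⦘

/-! RC11-style variants -/

def rsRC11 : REv := ⦗G.W⦘ ⬝ rcl G.poloc ⬝ rtcl (G.rf ⬝ G.rmw)

def releaseRC11 : REv := (⦗G.Wrel⦘ ∪ᵣ ⦗G.FgeRel⦘ ⬝ G.po) ⬝ G.rsRC11

def swRC11 : REv := G.releaseRC11 ⬝ G.rf ⬝ (⦗G.Racq⦘ ∪ᵣ G.po ⬝ ⦗G.FgeAcq⦘)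

def hbRC11 : REv := tcl (G.po ∪ᵣ G.swRC11)

end Execution

/-- Well-formedness of an IMM execution graph -/
structure ExecWf (G : Execution) : Prop where
  finE : G.E.Finite
  init_lab : ∀ x, Event.init x ∈ G.E →
    G.lab (Event.init x) = Label.write .rlx x 0 .normal
  read_mode : ∀ e ∈ G.E, ∀ o x v s, G.lab e = .read o x v s → o = Mode.rlx ∨ o = Mode.acq
  write_mode : ∀ e ∈ G.E, ∀ o x v st, G.lab e = .write o x v st → o = Mode.rlx ∨ o = Mode.rel
  fence_mode : ∀ e ∈ G.E, ∀ o, G.lab e = .fence o →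
    o = Mode.acq ∨ o = Mode.rel ∨ o = Mode.acqrel ∨ o = Mode.sc
  rmw_sub : ∀ a b, G.rmw a b → a ∈ G.Rex ∧ b ∈ G.W ∧ G.sameLoc a b ∧ immediate G.po a b
  strong_rmw : G.Wstrong ⊆ rcodom G.rmw
  data_sub : ∀ a b, G.data a b → a ∈ G.R ∧ G.po a b ∧ b ∈ G.W
  addr_sub : ∀ a b, G.addr a b → a ∈ G.R ∧ G.po a b ∧ (b ∈ G.R ∨ b ∈ G.W)
  ctrl_sub : ∀ a b, G.ctrl a b → a ∈ G.R ∧ G.po a b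
  ctrl_po : ∀ a b c, G.ctrl a b → G.po b c → G.ctrl a c
  casdep_sub : ∀ a b, G.casdep a b → a ∈ G.R ∧ G.po a b ∧ b ∈ G.Rex
  rf_sub : ∀ a b, G.rf a b → a ∈ G.W ∧ b ∈ G.R ∧ G.sameLoc a b
  rf_val : ∀ a b, G.rf a b → G.valu a = G.valu b
  rf_func : ∀ a b c, G.rf a c → G.rf b c → a = b
  co_sub : ∀ a b, G.co a b → a ∈ G.W ∧ b ∈ G.W ∧ G.sameLoc a b
  co_trans : Transitive G.co
  co_irr : Irreflexive G.co

/-- IMM-consistency (Definition 3.1) -/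
def IMMConsistent (G : Execution) : Prop :=
  rcodom G.rf = G.R ∧
  (∀ x, totalOn (G.Wloc x) G.co) ∧
  Irreflexive (G.hb ⬝ rcl G.eco) ∧
  (∀ a b, G.rmw a b → ¬ (G.fre ⬝ G.coe) a b) ∧
  acyclic G.ar

/-- `hb` restricted to pairs of accesses of the same location -/
def Execution.hbloc (G : Execution) : REv := fun a b => G.hb a b ∧ G.sameLoc a b

namespace Execution

variable {G : Execution}

theorem po_irrefl (a : Event) : ¬ G.po a a := by
  rintro ⟨-, -, h⟩
  cases a <;> simp [evLt] at h

theorem po_trans {a b c : Event} (hab : G.po a b) (hbc : G.po b c) : G.po a c := by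
  obtain ⟨ha, -, hab⟩ := hab
  obtain ⟨-, hc, hbc⟩ := hbc
  refine ⟨ha, hc, ?_⟩
  cases a <;> cases b <;> cases c <;> grind [evLt]

theorem sameLoc_trans {a b c : Event} (hab : G.sameLoc a b) (hbc : G.sameLoc b c) :
    G.sameLoc a c := by
  obtain ⟨x, ha, hb⟩ := hab
  obtain ⟨y, hb', hc⟩ := hbc
  exact ⟨x, ha, by rw [hc, ← hb', hb]⟩

theorem sameLoc_symm {a b : Event} (hab : G.sameLoc a b) : G.sameLoc b a := by
  obtain ⟨x, ha, hb⟩ := hab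
  exact ⟨x, hb, ha⟩

theorem hb_of_po {a b : Event} (h : G.po a b) : G.hb a b :=
  Relation.TransGen.single (Or.inl h)

theorem hb_trans {a b c : Event} (hab : G.hb a b) (hbc : G.hb b c) : G.hb a c :=
  Relation.TransGen.trans hab hbc

theorem hbloc_of_poloc {a b : Event} (h : G.poloc a b) : G.hbloc a b :=
  ⟨hb_of_po h.1, h.2⟩

/-- The relation whose acyclicity expresses per-location coherence. -/
def cohStep (G : Execution) : REv := G.hbloc ∪ᵣ G.rf ∪ᵣ G.co ∪ᵣ G.fr

theorem cohStep_of_hbloc {a b : Event} (h : G.hbloc a b) : G.cohStep a b :=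
  Or.inl (Or.inl (Or.inl h))

theorem cohStep_of_rf {a b : Event} (h : G.rf a b) : G.cohStep a b :=
  Or.inl (Or.inl (Or.inr h))

theorem cohStep_of_co {a b : Event} (h : G.co a b) : G.cohStep a b :=
  Or.inl (Or.inr h)

theorem cohStep_of_fr {a b : Event} (h : G.fr a b) : G.cohStep a b :=
  Or.inr h

theorem sameLoc_of_fr (hwf : ExecWf G) {a b : Event} (h : G.fr a b) : G.sameLoc a b := by
  obtain ⟨w, hw, hco⟩ := h
  exact sameLoc_trans (sameLoc_symm (hwf.rf_sub _ _ hw).2.2) (hwf.co_sub _ _ hco).2.2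

theorem sameLoc_of_tcl_cohStep (hwf : ExecWf G) {a b : Event} (h : tcl G.cohStep a b) :
    G.sameLoc a b := by
  have step : ∀ {a b}, G.cohStep a b → G.sameLoc a b := by
    rintro a b (((h | h) | h) | h)
    · exact h.2
    · exact (hwf.rf_sub _ _ h).2.2
    · exact (hwf.co_sub _ _ h).2.2
    · exact sameLoc_of_fr hwf h
  induction h with
  | single h => exact step h
  | tail _ h ih => exact sameLoc_trans ih (step h)

theorem tcl_cohStep_of_eco {a b : Event} (h : G.eco a b) : tcl G.cohStep a b := by
  rcases h with (h | ⟨c, h, rfl | h'⟩) | ⟨c, h, rfl | h'⟩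
  · exact .single (cohStep_of_rf h)
  · exact .single (cohStep_of_co h)
  · exact .tail (.single (cohStep_of_co h)) (cohStep_of_rf h')
  · exact .single (cohStep_of_fr h)
  · exact .tail (.single (cohStep_of_fr h)) (cohStep_of_rf h')

theorem rtcl_cohStep_of_poloc {a b : Event} (h : rcl G.poloc a b) : rtcl G.cohStep a b := by
  rcases h with rfl | h
  · exact .refl
  · exact .single (cohStep_of_hbloc (hbloc_of_poloc h))

theorem rtcl_cohStep_of_rs (hwf : ExecWf G) {a b : Event} (h : G.rs a b) :
    rtcl G.cohStep a b := by
  rcases h with ⟨_, ⟨rfl, -⟩, _, h, ⟨rfl, -⟩⟩ | ⟨_, ⟨rfl, -⟩, h⟩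
  · exact rtcl_cohStep_of_poloc (Or.inr h)
  · induction h with
    | refl => exact .refl
    | tail _ h ih =>
      obtain ⟨c, hc, d, hd, hrmw⟩ := h
      obtain ⟨-, -, hl, hpo, -⟩ := hwf.rmw_sub _ _ hrmw
      exact ((ih.trans (rtcl_cohStep_of_poloc hc)).tail (cohStep_of_rf hd)).tail
        (cohStep_of_hbloc (hbloc_of_poloc ⟨hpo, hl⟩))

/-- Every synchronization edge runs through a coherence path from a write to a read. -/
theorem exists_cohStep_path_of_sw (hwf : ExecWf G) {a b : Event} (h : G.sw a b) :
    ∃ w r, rcl G.po a w ∧ tcl G.cohStep w r ∧ rcl G.po r b := by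
  obtain ⟨u, ⟨w, hw, hrs⟩, r, hr, hb⟩ := h
  refine ⟨w, r, ?_, ?_, ?_⟩
  · rcases hw with ⟨rfl, -⟩ | ⟨_, ⟨rfl, -⟩, h⟩
    · exact Or.inl rfl
    · exact Or.inr h
  · have hrs := rtcl_cohStep_of_rs hwf hrs
    rcases hr with h | ⟨c, hc, h⟩
    · exact Relation.TransGen.tail' hrs (cohStep_of_rf h.1)
    · exact Relation.TransGen.tail' (hrs.trans (rtcl_cohStep_of_poloc hc)) (cohStep_of_rf h.1)
  · rcases hb with ⟨rfl, -⟩ | ⟨_, h, ⟨rfl, -⟩⟩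
    · exact Or.inl rfl
    · exact Or.inr h

theorem po_or_exists_sw_of_hb {a b : Event} (h : G.hb a b) :
    G.po a b ∨ ∃ c d, rcl G.hb a c ∧ G.sw c d ∧ rcl G.hb d b := by
  induction h with
  | single h =>
    rcases h with h | h
    · exact Or.inl h
    · exact Or.inr ⟨_, _, Or.inl rfl, h, Or.inl rfl⟩
  | tail hab h ih =>
    rcases h with h | h
    · rcases ih with ih | ⟨c, d, hc, hcd, hd⟩
      · exact Or.inl (po_trans ih h)
      · refine Or.inr ⟨c, d, hc, hcd, Or.inr ?_⟩
        rcases hd with rfl | hd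
        · exact hb_of_po h
        · exact hb_trans hd (hb_of_po h)
    · exact Or.inr ⟨_, _, Or.inr hab, h, Or.inl rfl⟩

theorem rcl_hb_trans {a b c : Event} (hab : rcl G.hb a b) (hbc : rcl G.hb b c) :
    rcl G.hb a c := by
  rcases hab with rfl | hab
  · exact hbc
  · rcases hbc with rfl | hbc
    · exact Or.inr hab
    · exact Or.inr (hb_trans hab hbc)

theorem rcl_hb_of_po {a b : Event} (h : rcl G.po a b) : rcl G.hb a b :=
  h.imp id hb_of_po

theorem hb_irrefl_of_acyclic (hwf : ExecWf G) (hac : acyclic G.cohStep) (a : Event) :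
    ¬ G.hb a a := by
  intro h
  rcases po_or_exists_sw_of_hb h with h | ⟨c, d, hac', hcd, hda⟩
  · exact po_irrefl a h
  · obtain ⟨w, r, hcw, hwr, hrd⟩ := exists_cohStep_path_of_sw hwf hcd
    have hrw : rcl G.hb r w :=
      rcl_hb_trans (rcl_hb_of_po hrd) (rcl_hb_trans hda (rcl_hb_trans hac' (rcl_hb_of_po hcw)))
    rcases hrw with rfl | hrw
    · exact hac _ hwr
    · exact hac _ (Relation.TransGen.tail hwr
        (cohStep_of_hbloc ⟨hrw, sameLoc_symm (sameLoc_of_tcl_cohStep hwf hwr)⟩))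

/-- `w` is the write observed by the access `e`: `e` itself for a write, the write it
reads from for a read. -/
def srcWrite (G : Execution) (e w : Event) : Prop := (e ∈ G.W ∧ w = e) ∨ G.rf w e

theorem not_mem_R_of_mem_W {e : Event} (hW : e ∈ G.W) : e ∉ G.R := by
  rintro ⟨-, o, x, v, s, h⟩
  obtain ⟨-, o', x', v', s', h'⟩ := hW
  simp [h] at h'

theorem srcWrite_unique (hwf : ExecWf G) {e w w' : Event} (h : G.srcWrite e w)
    (h' : G.srcWrite e w') : w = w' := by
  rcases h with ⟨he, rfl⟩ | h <;> rcases h' with ⟨he', rfl⟩ | h'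
  · rfl
  · exact absurd (hwf.rf_sub _ _ h').2.1 (not_mem_R_of_mem_W he)
  · exact absurd (hwf.rf_sub _ _ h).2.1 (not_mem_R_of_mem_W he')
  · exact hwf.rf_func _ _ _ h h'

theorem eco_of_co_srcWrite {a b wa wb : Event} (ha : G.srcWrite a wa) (hb : G.srcWrite b wb)
    (h : G.co wa wb) : G.eco a b := by
  rcases ha with ⟨-, rfl⟩ | ha <;> rcases hb with ⟨-, rfl⟩ | hb
  · exact Or.inl (Or.inr ⟨_, h, Or.inl rfl⟩)
  · exact Or.inl (Or.inr ⟨_, h, Or.inr hb⟩)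
  · exact Or.inr ⟨_, ⟨_, ha, h⟩, Or.inl rfl⟩
  · exact Or.inr ⟨_, ⟨_, ha, h⟩, Or.inr hb⟩

/-- Accesses ordered lexicographically: by coherence of the observed writes, then a write
before its readers, then readers of the same write by happens-before. -/
def cohOrder (G : Execution) : REv := fun a b =>
  ∃ wa wb, G.srcWrite a wa ∧ G.srcWrite b wb ∧
    (G.co wa wb ∨ wa = wb ∧ b ∈ G.R ∧ (a ∈ G.W ∨ a ∈ G.R ∧ G.hb a b))

theorem cohOrder_irrefl (hwf : ExecWf G) (hirr : ∀ a, ¬ G.hb a a) (a : Event) :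
    ¬ G.cohOrder a a := by
  rintro ⟨w, w', hw, hw', h⟩
  obtain rfl := srcWrite_unique hwf hw hw'
  rcases h with h | ⟨-, hR, hW | ⟨-, h⟩⟩
  · exact hwf.co_irr _ h
  · exact not_mem_R_of_mem_W hW hR
  · exact hirr a h

theorem cohOrder_trans (hwf : ExecWf G) {a b c : Event} (hab : G.cohOrder a b)
    (hbc : G.cohOrder b c) : G.cohOrder a c := by
  obtain ⟨wa, wb, ha, hb, hab⟩ := hab
  obtain ⟨wb', wc, hb', hc, hbc⟩ := hbc
  obtain rfl := srcWrite_unique hwf hb hb'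
  refine ⟨wa, wc, ha, hc, ?_⟩
  rcases hab with hab | ⟨rfl, hbR, hab⟩ <;> rcases hbc with hbc | ⟨rfl, hcR, hbc⟩
  · exact Or.inl (hwf.co_trans hab hbc)
  · exact Or.inl hab
  · exact Or.inl hbc
  · refine Or.inr ⟨rfl, hcR, ?_⟩
    rcases hbc with hbW | ⟨-, hbc⟩
    · exact absurd hbR (not_mem_R_of_mem_W hbW)
    · exact hab.imp id fun h => ⟨h.1, hb_trans h.2 hbc⟩

theorem mem_E_of_hb {a b : Event} (h : G.hb a b) : a ∈ G.E ∧ b ∈ G.E := by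
  have step : ∀ {a b}, (G.po ∪ᵣ G.sw) a b → a ∈ G.E ∧ b ∈ G.E := by
    rintro a b (h | ⟨u, ⟨w, hw, -⟩, r, -, hb⟩)
    · exact ⟨h.1, h.2.1⟩
    · constructor
      · rcases hw with ⟨rfl, h⟩ | ⟨_, ⟨rfl, h⟩, -⟩ <;> exact h.1
      · rcases hb with ⟨rfl, h⟩ | ⟨_, -, ⟨rfl, h⟩⟩ <;> exact h.1
  induction h with
  | single h => exact step h
  | tail _ h ih => exact ⟨ih.1, (step h).2⟩

theorem mem_W_or_mem_R {a : Event} {x : Loc} (ha : a ∈ G.E) (hx : G.loc a = some x) :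
    a ∈ G.W ∨ a ∈ G.R := by
  cases h : G.lab a with
  | read o y v s => exact Or.inr ⟨ha, _, _, _, _, h⟩
  | write o y v s => exact Or.inl ⟨ha, _, _, _, _, h⟩
  | fence o => simp [loc, h, Label.locOf] at hx

theorem exists_srcWrite (hwf : ExecWf G) (hcomp : rcodom G.rf = G.R) {a : Event} {x : Loc}
    (ha : a ∈ G.W ∨ a ∈ G.R) (hx : G.loc a = some x) :
    ∃ w ∈ G.Wloc x, G.srcWrite a w := by
  rcases ha with ha | ha
  · exact ⟨a, ⟨ha, hx⟩, Or.inl ⟨ha, rfl⟩⟩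
  · rw [← hcomp] at ha
    obtain ⟨w, hw⟩ := ha
    obtain ⟨hW, -, y, hwy, hay⟩ := hwf.rf_sub _ _ hw
    exact ⟨w, ⟨hW, by rw [hwy, ← hay, hx]⟩, Or.inr hw⟩

theorem rf_of_srcWrite {a w : Event} (ha : a ∈ G.R) (h : G.srcWrite a w) : G.rf w a := by
  rcases h with ⟨hW, -⟩ | h
  · exact absurd ha (not_mem_R_of_mem_W hW)
  · exact h

theorem eq_of_srcWrite (hwf : ExecWf G) {a w : Event} (ha : a ∈ G.W) (h : G.srcWrite a w) :
    w = a :=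
  srcWrite_unique hwf h (Or.inl ⟨ha, rfl⟩)

theorem cohOrder_of_hbloc (hwf : ExecWf G) (hcomp : rcodom G.rf = G.R)
    (htot : ∀ x, totalOn (G.Wloc x) G.co) (hirr : Irreflexive (G.hb ⬝ rcl G.eco))
    {a b : Event} (h : G.hbloc a b) : G.cohOrder a b := by
  obtain ⟨h, x, hax, hbx⟩ := h
  obtain ⟨haE, hbE⟩ := mem_E_of_hb h
  have ha := mem_W_or_mem_R haE hax
  have hb := mem_W_or_mem_R hbE hbx
  obtain ⟨wa, hwa, hsa⟩ := exists_srcWrite hwf hcomp ha hax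
  obtain ⟨wb, hwb, hsb⟩ := exists_srcWrite hwf hcomp hb hbx
  refine ⟨wa, wb, hsa, hsb, ?_⟩
  by_cases heq : wa = wb
  · subst heq
    rcases hb with hb | hb
    · obtain rfl := eq_of_srcWrite hwf hb hsb
      rcases ha with ha | ha
      · obtain rfl := eq_of_srcWrite hwf ha hsa
        exact absurd ⟨_, h, Or.inl rfl⟩ (hirr _)
      · exact absurd ⟨_, h, Or.inr (Or.inl (Or.inl (rf_of_srcWrite ha hsa)))⟩ (hirr a)
    · exact Or.inr ⟨rfl, hb, ha.imp id fun ha => ⟨ha, h⟩⟩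
  · rcases htot x _ hwa _ hwb heq with hco | hco
    · exact Or.inl hco
    · exact absurd ⟨_, h, Or.inr (eco_of_co_srcWrite hsb hsa hco)⟩ (hirr a)

theorem cohOrder_of_cohStep (hwf : ExecWf G) (hcomp : rcodom G.rf = G.R)
    (htot : ∀ x, totalOn (G.Wloc x) G.co) (hirr : Irreflexive (G.hb ⬝ rcl G.eco))
    {a b : Event} (h : G.cohStep a b) : G.cohOrder a b := by
  rcases h with ((h | h) | h) | ⟨w, hw, h⟩
  · exact cohOrder_of_hbloc hwf hcomp htot hirr h
  · obtain ⟨ha, hb, -⟩ := hwf.rf_sub _ _ h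
    exact ⟨a, a, Or.inl ⟨ha, rfl⟩, Or.inr h, Or.inr ⟨rfl, hb, Or.inl ha⟩⟩
  · obtain ⟨ha, hb, -⟩ := hwf.co_sub _ _ h
    exact ⟨a, b, Or.inl ⟨ha, rfl⟩, Or.inl ⟨hb, rfl⟩, Or.inl h⟩
  · exact ⟨w, b, Or.inr hw, Or.inl ⟨(hwf.co_sub _ _ h).2.1, rfl⟩, Or.inl h⟩

end Execution

/-- for a well-formed IMM execution graph satisfying rf-completeness and
co-totality, `hb;eco^?` is irreflexive iff `hb|loc ∪ rf ∪ co ∪ fr` is acyclic. -/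
theorem coherence_characterization (G : Execution) (hwf : ExecWf G)
    (hcomp : rcodom G.rf = G.R)
    (htot : ∀ x, totalOn (G.Wloc x) G.co) :
    Irreflexive (G.hb ⬝ rcl G.eco) ↔ acyclic (G.hbloc ∪ᵣ G.rf ∪ᵣ G.co ∪ᵣ G.fr) := by
  constructor
  · intro hirr a ha
    have hle : ∀ {a b}, tcl G.cohStep a b → G.cohOrder a b := by
      intro a b h
      induction h with
      | single h => exact Execution.cohOrder_of_cohStep hwf hcomp htot hirr h
      | tail _ h ih =>
        exact Execution.cohOrder_trans hwf ih
          (Execution.cohOrder_of_cohStep hwf hcomp htot hirr h)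
    exact Execution.cohOrder_irrefl hwf (fun b hb => hirr b ⟨b, hb, Or.inl rfl⟩) a (hle ha)
  · rintro hac a ⟨b, hab, rfl | hba⟩
    · exact Execution.hb_irrefl_of_acyclic hwf hac _ hab
    · have hpath := Execution.tcl_cohStep_of_eco hba
      exact hac _ (Relation.TransGen.tail hpath (Execution.cohStep_of_hbloc
        ⟨hab, Execution.sameLoc_symm (Execution.sameLoc_of_tcl_cohStep hwf hpath)⟩))
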